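/- For every m ≥ 1, lim_{n→∞} M^{(m)}(n)/n^{mp²} = (1−x)^{mp}. Consequently, if x ≠ 1, then M^{(m)}(n) ≠ 0 for all sufficiently large n. -/

import Mathlib

open Filter Finset

/-- The Pochhammer symbol `(z)_n = z (z+1) ⋯ (z+n-1)` over `ℂ`. -/
noncomputable def poch (z : ℂ) (n : ℕ) : ℂ := (ascPochhammer ℂ n).eval z

/-- The terms `a_n = ([α]_n / [β]_n) · x^n` of the generalized hypergeometric series. -/
noncomputable def term (p : ℕ) (α β : Fin p → ℂ) (x : ℂ) (n : ℕ) : ℂ :=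
  ((∏ i, poch (α i) n) / (∏ i, poch (β i) n)) * x ^ n

/-- The partial sums `s_n = ∑_{j=0}^{n-1} a_j`. -/
noncomputable def psum (p : ℕ) (α β : Fin p → ℂ) (x : ℂ) (n : ℕ) : ℂ :=
  ∑ j ∈ Finset.range n, term p α β x j

/-- The coefficients `λ_j^{(m)}(n)`. -/
noncomputable def lam (p : ℕ) (α β : Fin p → ℂ) (x : ℂ) (m j n : ℕ) : ℂ :=
  ((m * p).choose j : ℂ) * (-x) ^ (m * p - j) *
    ∏ i, (poch (α i + (n : ℂ) + (j : ℂ)) (m * p - j) * poch (β i + (n : ℂ) + (m : ℂ) - 1) j)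

/-- `M_k^{(m)}(n) = ∑_{j=k}^{mp} λ_j^{(m)}(n)`; `M^{(m)}(n)` is the case `k = 0`. -/
noncomputable def Mk (p : ℕ) (α β : Fin p → ℂ) (x : ℂ) (m k n : ℕ) : ℂ :=
  ∑ j ∈ Finset.Icc k (m * p), lam p α β x m j n

/-- The transformation `Q_n^{(m)}`. -/
noncomputable def Qt (p : ℕ) (α β : Fin p → ℂ) (x : ℂ) (m n : ℕ) : ℂ :=
  (∑ j ∈ Finset.range (m * p + 1), lam p α β x m j n * psum p α β x (n + j)) /
    Mk p α β x m 0 n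

/-- The shifted Pochhammer symbol `(c + n)_k` is asymptotic to `n ^ k`. -/
theorem tendsto_poch_add_div_pow (c : ℂ) (k : ℕ) :
    Filter.Tendsto (fun n : ℕ => poch (c + (n : ℂ)) k / (n : ℂ) ^ k) Filter.atTop (nhds 1) := by
  induction k with
  | zero => simp [poch]
  | succ k ih =>
    have hinv : Filter.Tendsto (fun n : ℕ => (c + k) / (n : ℂ)) Filter.atTop (nhds 0) :=
      tendsto_const_div_atTop_nhds_zero_nat _
    have hprod := ih.mul (hinv.add_const 1)
    rw [zero_add, one_mul] at hprod
    refine hprod.congr' ?_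
    filter_upwards [Filter.eventually_ne_atTop 0] with n hn
    have hn' : (n : ℂ) ≠ 0 := Nat.cast_ne_zero.mpr hn
    simp only [poch, ascPochhammer_succ_eval]
    field_simp
    ring

/-- The leading asymptotics of the coefficients `λ_j^{(m)}(n)`. -/
theorem tendsto_lam_div_pow (p : ℕ) (α β : Fin p → ℂ) (x : ℂ) {m j : ℕ} (hj : j ≤ m * p) :
    Filter.Tendsto (fun n : ℕ => lam p α β x m j n / (n : ℂ) ^ (m * p ^ 2))
      Filter.atTop (nhds (((m * p).choose j : ℂ) * (-x) ^ (m * p - j))) := by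
  have hprod := (tendsto_finsetProd (Finset.univ : Finset (Fin p)) fun i _ =>
    (tendsto_poch_add_div_pow (α i + j) (m * p - j)).mul
      (tendsto_poch_add_div_pow (β i + m - 1) j)).const_mul
    (((m * p).choose j : ℂ) * (-x) ^ (m * p - j))
  simp only [mul_one, Finset.prod_const_one] at hprod
  refine hprod.congr fun n => ?_
  have hpow : (n : ℂ) ^ (m * p ^ 2) = ∏ _i : Fin p, ((n : ℂ) ^ (m * p - j) * (n : ℂ) ^ j) := by
    rw [← pow_add, Nat.sub_add_cancel hj, Finset.prod_const, Finset.card_univ, Fintype.card_fin,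
      ← pow_mul, mul_assoc, sq]
  rw [lam, hpow, mul_div_assoc, ← Finset.prod_div_distrib]
  congr 1
  refine Finset.prod_congr rfl fun i _ => ?_
  rw [div_mul_div_comm, add_right_comm (α i),
    show β i + m - 1 + (n : ℂ) = β i + n + m - 1 by ring]

/-- `lim_{n→∞} M^{(m)}(n)/n^{mp²} = (1-x)^{mp}`; consequently, if `x ≠ 1`, then
`M^{(m)}(n) ≠ 0` for all sufficiently large `n`. -/
theorem M_leading_coefficient
    (p : ℕ) (hp : 1 ≤ p) (α β : Fin p → ℂ) (x : ℂ)
    (m : ℕ) (hm : 1 ≤ m) :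
    Filter.Tendsto (fun n : ℕ => Mk p α β x m 0 n / (n : ℂ) ^ (m * p ^ 2))
        Filter.atTop (nhds ((1 - x) ^ (m * p))) ∧
      (x ≠ 1 → ∀ᶠ n in Filter.atTop, Mk p α β x m 0 n ≠ 0) := by
  have hlim : Filter.Tendsto (fun n : ℕ => Mk p α β x m 0 n / (n : ℂ) ^ (m * p ^ 2))
      Filter.atTop (nhds ((1 - x) ^ (m * p))) := by
    have hsum := tendsto_finsetSum (Finset.Icc 0 (m * p)) fun j hj =>
      tendsto_lam_div_pow p α β x (Finset.mem_Icc.mp hj).2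
    simp only [← Finset.sum_div] at hsum
    have hbinom : (1 - x) ^ (m * p) =
        ∑ j ∈ Finset.Icc 0 (m * p), ((m * p).choose j : ℂ) * (-x) ^ (m * p - j) := by
      rw [sub_eq_add_neg, add_pow, Finset.range_eq_Ico, Finset.Ico_add_one_right_eq_Icc]
      exact Finset.sum_congr rfl fun j _ => by ring
    rw [hbinom]
    exact hsum
  refine ⟨hlim, fun hx => ?_⟩
  filter_upwards [hlim.eventually_ne (pow_ne_zero _ (sub_ne_zero.mpr hx.symm))] with n hn h0
  exact hn (by rw [h0, zero_div])
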